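/- Counterexample to the Kiyota–Murai–Wada conjecture on the level of matrices: there exists a symmetric, positive definite, entrywise nonnegative 3×3 integer matrix C (namely C = [[10,10,5],[10,13,6],[5,6,7]]) whose largest real eigenvalue equals its largest elementary divisor 25 (so the spectral radius is a rational integer), yet C has a real eigenvalue, namely (5 + √5)/2, that is irrational; in particular the multiset of eigenvalues of C differs from the multiset of its elementary divisors. -/

import Mathlib

open Polynomial

theorem eval_charpoly_psu_three_four (t : ℝ) :
    (!![10, 10, 5; 10, 13, 6; 5, 6, 7] : Matrix (Fin 3) (Fin 3) ℝ).charpoly.eval t =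
      (t - 25) * (t ^ 2 - 5 * t + 5) := by
  rw [Matrix.eval_charpoly, Matrix.det_fin_three]
  simp [Matrix.scalar_apply]
  ring

theorem mem_spectrum_psu_three_four_iff (t : ℝ) :
    t ∈ spectrum ℝ (!![10, 10, 5; 10, 13, 6; 5, 6, 7] : Matrix (Fin 3) (Fin 3) ℝ) ↔
      (t - 25) * (t ^ 2 - 5 * t + 5) = 0 := by
  rw [Matrix.mem_spectrum_iff_isRoot_charpoly, IsRoot.def, eval_charpoly_psu_three_four]

theorem posDef_psu_three_four :
    (!![10, 10, 5; 10, 13, 6; 5, 6, 7] : Matrix (Fin 3) (Fin 3) ℝ).PosDef := by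
  refine .of_dotProduct_mulVec_pos ?_ fun x hx => ?_
  · ext i j
    fin_cases i <;> fin_cases j <;> simp
  · have hsq : star x ⬝ᵥ (!![10, 10, 5; 10, 13, 6; 5, 6, 7] : Matrix (Fin 3) (Fin 3) ℝ).mulVec x =
        10 * (x 0 + x 1 + x 2 / 2) ^ 2 + (x 1 + x 2) ^ 2 + 2 * x 1 ^ 2 + 7 / 2 * x 2 ^ 2 := by
      simp [dotProduct, Matrix.mulVec, Fin.sum_univ_three]
      ring
    rw [hsq]
    by_contra! h
    have h2 : x 2 = 0 := by
      nlinarith [sq_nonneg (x 0 + x 1 + x 2 / 2), sq_nonneg (x 1 + x 2), sq_nonneg (x 1)]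
    have h1 : x 1 = 0 := by
      nlinarith [sq_nonneg (x 0 + x 1 + x 2 / 2), sq_nonneg (x 1 + x 2), sq_nonneg (x 2)]
    have h0 : x 0 = 0 := by
      rw [h1, h2] at h
      nlinarith
    exact hx (by ext i; fin_cases i <;> assumption)

theorem irrational_five_add_sqrt_five_div_two : Irrational ((5 + Real.sqrt 5) / 2) := by
  have h : Irrational (Real.sqrt 5) := by
    exact_mod_cast Nat.Prime.irrational_sqrt Nat.prime_five
  exact_mod_cast (h.ratCast_add 5).div_ratCast (q := 2) two_ne_zero

theorem counterexample_kiyota_murai_wada :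
    ∃ C : Matrix (Fin 3) (Fin 3) ℤ,
      C = !![10, 10, 5; 10, 13, 6; 5, 6, 7] ∧
      C.IsSymm ∧
      (C.map (Int.cast : ℤ → ℝ)).PosDef ∧
      (∀ i j, 0 ≤ C i j) ∧
      -- the largest real eigenvalue equals the largest elementary divisor 25,
      -- so the spectral radius is a rational integer
      IsGreatest (spectrum ℝ (C.map (Int.cast : ℤ → ℝ))) 25 ∧
      -- yet (5 + √5)/2 is an irrational eigenvalue of C
      (5 + Real.sqrt 5) / 2 ∈ spectrum ℝ (C.map (Int.cast : ℤ → ℝ)) ∧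
      Irrational ((5 + Real.sqrt 5) / 2) ∧
      -- in particular the multiset of real eigenvalues of C differs from
      -- the multiset {1, 5, 25} of its elementary divisors
      (C.map (Int.cast : ℤ → ℝ)).charpoly.roots ≠ ({1, 5, 25} : Multiset ℝ) := by
  have hmap : (!![10, 10, 5; 10, 13, 6; 5, 6, 7] : Matrix (Fin 3) (Fin 3) ℤ).map
      (Int.cast : ℤ → ℝ) = !![10, 10, 5; 10, 13, 6; 5, 6, 7] := by
    ext i j
    fin_cases i <;> fin_cases j <;> simp
  refine ⟨!![10, 10, 5; 10, 13, 6; 5, 6, 7], rfl, ?_⟩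
  rw [hmap]
  refine ⟨by decide, posDef_psu_three_four,
    fun i j => by fin_cases i <;> fin_cases j <;> simp, ⟨?_, fun t ht => ?_⟩, ?_,
    irrational_five_add_sqrt_five_div_two, fun h => ?_⟩
  · rw [mem_spectrum_psu_three_four_iff]
    norm_num
  · rw [mem_spectrum_psu_three_four_iff] at ht
    rcases mul_eq_zero.mp ht with h | h <;> nlinarith
  · rw [mem_spectrum_psu_three_four_iff]
    have h5 : Real.sqrt 5 ^ 2 = 5 := Real.sq_sqrt (by norm_num)
    linear_combination ((5 + Real.sqrt 5) / 2 - 25) / 4 * h5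
  · have h1 : (1 : ℝ) ∈
        (!![10, 10, 5; 10, 13, 6; 5, 6, 7] : Matrix (Fin 3) (Fin 3) ℝ).charpoly.roots := by
      simp [h]
    have h0 := (mem_roots'.mp h1).2
    rw [IsRoot.def, eval_charpoly_psu_three_four] at h0
    norm_num at h0
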